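/- Zagier's theta identity in explicit lattice form: For j ∈ ℤ let S_j := {x ∈ ℤ¹⁰ : xᵀMx = −1, xᵀMf = 1, xᵀMt = j} (the section classes of t-degree j on a rational elliptic surface). Then S_j is empty for j < 0, each S_j is finite, and for every n ∈ ℕ one has ∑ |S_j|·p(k₁)·p(k₂)···p(k₁₂) = 9·∑ p(m₁)·p(m₂)·p(m₃)·p(m₄), where the left sum runs over all j ∈ ℕ and (k₁,…,k₁₂) ∈ ℕ¹² with j + 3(k₁+⋯+k₁₂) = n, and the right sum runs over all (m₁,m₂,m₃,m₄) ∈ ℕ⁴ with m₁+m₂+m₃+m₄ = n. (This is the identity Θ_{E₈}(q³; q², q, 1, 1, 1, 1, 1, q⁻¹)·P(q³)¹² = 9·P(q)⁴ of formal power series, where P(q) = ∑ p(i)qⁱ is the partition generating function.) -/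

import Mathlib

open Matrix

/-- The intersection form of the dP₉ surface in the basis
(σ, f, θ₁₁, θ₂₁, θ₃₁, θ₃₂, θ₄₁, θ₄₂, μ, ν). -/
def Mmat : Matrix (Fin 10) (Fin 10) ℤ :=
  !![-1,1,0,0,0,0,0,0,0,0;
     1,0,0,0,0,0,0,0,1,1;
     0,0,-2,0,0,0,0,0,0,1;
     0,0,0,-2,0,0,0,0,1,0;
     0,0,0,0,-2,1,0,0,1,0;
     0,0,0,0,1,-2,0,0,0,1;
     0,0,0,0,0,0,-2,1,1,1;
     0,0,0,0,0,0,1,-2,0,0;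
     0,1,0,1,1,0,1,0,-1,0;
     0,1,1,0,0,1,1,0,0,-1]

/-- The fiber class `f`. -/
def fvec : Fin 10 → ℤ := ![0,1,0,0,0,0,0,0,0,0]

/-- The class `t`, pull-back of the hyperplane class. -/
def tvec : Fin 10 → ℤ := ![-3,-3,1,1,2,2,3,1,3,3]

/-- `S j`: the section classes of `t`-degree `j`, i.e. `x` with
`xᵀMx = -1`, `xᵀMf = 1` and `xᵀMt = j`. -/
def sectionClasses (j : ℤ) : Set (Fin 10 → ℤ) :=
  {x | x ⬝ᵥ Mmat.mulVec x = -1 ∧ x ⬝ᵥ Mmat.mulVec fvec = 1 ∧ x ⬝ᵥ Mmat.mulVec tvec = j}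

/-- `p n` is the number of partitions of `n`. -/
def partitionCount (n : ℕ) : ℕ := Fintype.card (Nat.Partition n)


/-! ### The lattice part -/

/-- The quadratic polynomial attached to 3-cores. -/
def coreQ (y : ℤ × ℤ) : ℤ := 3 * (y.1 ^ 2 + y.1 * y.2 + y.2 ^ 2) - y.1 + y.2

/-- Triples of integers with sum `-1`, in one of three residue classes. -/
def tri (r : Fin 3) (y : ℤ × ℤ) : Fin 3 → ℤ :=
  match r with
  | 0 => ![y.1 - y.2 - 1, y.1 + 2 * y.2, -2 * y.1 - y.2]
  | 1 => ![-2 * y.1 - y.2, y.1 - y.2 - 1, y.1 + 2 * y.2]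
  | 2 => ![y.1 + 2 * y.2, -2 * y.1 - y.2, y.1 - y.2 - 1]

lemma tri_sum (r : Fin 3) (y : ℤ × ℤ) : tri r y 0 + tri r y 1 + tri r y 2 = -1 := by
  fin_cases r <;> simp [tri] <;> ring

lemma tri_sq (r : Fin 3) (y : ℤ × ℤ) :
    tri r y 0 ^ 2 + tri r y 1 ^ 2 + tri r y 2 ^ 2 = 2 * coreQ y + 1 := by
  fin_cases r <;> simp [tri, coreQ] <;> ring

lemma tri_mod (r : Fin 3) (y : ℤ × ℤ) : (3 : ℤ) ∣ tri r y 1 - tri r y 0 - 1 - (r.val : ℤ) := by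
  fin_cases r <;> simp [tri] <;> omega

lemma tri_mod' (r : Fin 3) (y : ℤ × ℤ) (i : Fin 3) :
    (3 : ℤ) ∣ tri r y i - (tri r y 0 + (r.val : ℤ) * i.val + i.val ^ 2) := by
  fin_cases r <;> fin_cases i <;> simp [tri] <;> omega

lemma tri_surj (m : Fin 3 → ℤ) (h : m 0 + m 1 + m 2 = -1) : ∃ r y, tri r y = m := by
  have key : (m 1 - m 0 - 1) % 3 = 0 ∨ (m 1 - m 0 - 1) % 3 = 1 ∨ (m 1 - m 0 - 1) % 3 = 2 := by
    omega
  rcases key with k | k | k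
  · refine ⟨0, (m 0 + 1 + (m 1 - m 0 - 1) / 3, (m 1 - m 0 - 1) / 3), ?_⟩
    ext i; fin_cases i <;> simp [tri] <;> omega
  · refine ⟨1, (m 1 + 1 + (m 2 - m 1 - 1) / 3, (m 2 - m 1 - 1) / 3), ?_⟩
    ext i; fin_cases i <;> simp [tri] <;> omega
  · refine ⟨2, (m 2 + 1 + (m 0 - m 2 - 1) / 3, (m 0 - m 2 - 1) / 3), ?_⟩
    ext i; fin_cases i <;> simp [tri] <;> omega

lemma tri_inj {r s : Fin 3} {y z : ℤ × ℤ} (h : tri r y = tri s z) : r = s ∧ y = z := by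
  have h0 := congrFun h 0
  have h1 := congrFun h 1
  have h2 := congrFun h 2
  have hrs : r = s := by
    have a := tri_mod r y
    have b := tri_mod s z
    rw [h0, h1] at a
    ext
    omega
  subst hrs
  refine ⟨rfl, ?_⟩
  obtain ⟨u, v⟩ := y
  obtain ⟨u', v'⟩ := z
  fin_cases r <;> simp [tri] at h0 h1 h2 <;> ext <;> simp <;> omega

lemma coreQ_nonneg (y : ℤ × ℤ) : 0 ≤ coreQ y := by
  obtain ⟨u, v⟩ := y
  simp only [coreQ]
  by_cases h : u - v ≤ 0
  · nlinarith [sq_nonneg (u + v), sq_nonneg (u - v)]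
  · by_cases h2 : u - v = 1
    · have hu : u = v + 1 := by omega
      subst hu
      nlinarith [sq_nonneg (v + 1), sq_nonneg (2 * v + 1)]
    · have h3 : 2 ≤ u - v := by omega
      nlinarith [sq_nonneg (u + v), sq_nonneg (u - v)]

/-- The parameter type for section classes. -/
abbrev Dat : Type := (Fin 3 × Fin 3) × ((ℤ × ℤ) × (ℤ × ℤ)) × ((ℤ × ℤ) × (ℤ × ℤ))

/-- Degree of a datum. -/
def degZ (d : Dat) : ℤ :=
  (coreQ d.2.1.1 + coreQ d.2.1.2) + (coreQ d.2.2.1 + coreQ d.2.2.2)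

/-- The four triples of a datum. -/
def dm (d : Dat) (c : Fin 4) : Fin 3 → ℤ :=
  match c with
  | 0 => tri d.1.1 d.2.1.1
  | 1 => tri d.1.2 d.2.1.2
  | 2 => tri (d.1.1 + d.1.2) d.2.2.1
  | 3 => tri (d.1.1 - d.1.2) d.2.2.2

/-- Three times the multiplicity at a point. -/
def tripleMult (j : ℤ) (m : Fin 4 → Fin 3 → ℤ) (x y : Fin 3) : ℤ :=
  j + 1 + m 0 x + m 1 y + m 2 (x + y) + m 3 (x - y)

/-- The class `j t - ∑ aᵢ Eᵢ`. -/
def mkClass (j : ℤ) (a : Fin 3 → Fin 3 → ℤ) : Fin 10 → ℤ :=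
  ![-3*j+3*a 0 0+2*a 0 1+2*a 0 2+a 1 0+a 1 1+a 1 2-a 2 2,
    -3*j+3*a 0 0+2*a 0 1+2*a 0 2+a 1 0+a 1 1+a 1 2,
    j-a 0 0-a 0 2-a 1 2,
    j-a 0 0-a 0 1-a 1 1,
    2*j-2*a 0 0-a 0 1-a 0 2-a 1 0-a 1 1,
    2*j-2*a 0 0-a 0 1-a 0 2-a 1 0-a 1 2,
    3*j-2*a 0 0-2*a 0 1-2*a 0 2-a 1 0-a 1 1-a 1 2,
    j-a 0 0-a 0 1-a 0 2,
    3*j-2*a 0 0-2*a 0 1-a 0 2-a 1 0-2*a 1 1-a 2 1,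
    3*j-2*a 0 0-a 0 1-2*a 0 2-a 1 0-2*a 1 2-a 2 0]

/-- The multiplicities `x · Eᵢ`. -/
def mult (x : Fin 10 → ℤ) : Fin 3 → Fin 3 → ℤ :=
  ![![x 1 + x 6, x 1 + x 2 + x 4, x 1 + x 3 + x 5],
    ![x 1 + x 2 + x 3 + x 7, x 1 + x 5 + x 7, x 1 + x 4 + x 7],
    ![x 1 + x 2 + x 5 + x 6 - x 9, x 1 + x 3 + x 4 + x 6 - x 8, -x 0 + x 1]]

/-- The degree `x · t`. -/
def tdeg (x : Fin 10 → ℤ) : ℤ := 3 * x 1 + x 2 + x 3 + x 4 + x 5 + x 6 + x 7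

/-- sums of multiplicities along lines of the affine plane over `F₃`. -/
def lineSum (a : Fin 3 → Fin 3 → ℤ) (c : Fin 4) : Fin 3 → ℤ :=
  match c with
  | 0 => ![a 0 0 + a 0 1 + a 0 2, a 1 0 + a 1 1 + a 1 2, a 2 0 + a 2 1 + a 2 2]
  | 1 => ![a 0 0 + a 1 0 + a 2 0, a 0 1 + a 1 1 + a 2 1, a 0 2 + a 1 2 + a 2 2]
  | 2 => ![a 0 0 + a 1 2 + a 2 1, a 0 1 + a 1 0 + a 2 2, a 0 2 + a 1 1 + a 2 0]
  | 3 => ![a 0 0 + a 1 1 + a 2 2, a 1 0 + a 2 1 + a 0 2, a 2 0 + a 0 1 + a 1 2]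

lemma mkClass_mult (x : Fin 10 → ℤ) (h : ∑ p, ∑ q, mult x p q = 3 * tdeg x - 1)
    (h' : x 0 + x 8 + x 9 = 1) :
    mkClass (tdeg x) (mult x) = x := by
  ext i
  simp [Fin.sum_univ_three, mult, tdeg] at h
  fin_cases i <;> simp [mkClass, mult, tdeg] <;> omega

lemma mult_mkClass (j : ℤ) (a : Fin 3 → Fin 3 → ℤ) (h : ∑ p, ∑ q, a p q = 3 * j - 1) :
    mult (mkClass j a) = a ∧ tdeg (mkClass j a) = j := by
  simp [Fin.sum_univ_three] at h
  constructor
  · ext p q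
    fin_cases p <;> fin_cases q <;> simp [mkClass, mult] <;> omega
  · simp [mkClass, tdeg]; omega

lemma mem_sectionClasses (x : Fin 10 → ℤ) (j : ℤ) :
    x ∈ sectionClasses j ↔
      tdeg x = j ∧ x 0 + x 8 + x 9 = 1 ∧
      ∑ p, ∑ q, mult x p q = 3 * j - 1 ∧ ∑ p, ∑ q, mult x p q ^ 2 = j ^ 2 + 1 := by
  have e1 : x ⬝ᵥ Mmat.mulVec x = tdeg x ^ 2 - ∑ p, ∑ q, mult x p q ^ 2 := by
    simp [Mmat, dotProduct, mulVec, Fin.sum_univ_succ, tdeg, mult]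
    ring
  have e2 : x ⬝ᵥ Mmat.mulVec fvec = x 0 + x 8 + x 9 := by
    simp [Mmat, fvec, dotProduct, mulVec, Fin.sum_univ_succ]
    ring
  have e2' : x 0 + x 8 + x 9 = 3 * tdeg x - ∑ p, ∑ q, mult x p q := by
    simp [Fin.sum_univ_succ, tdeg, mult]
    ring
  have e3 : x ⬝ᵥ Mmat.mulVec tvec = tdeg x := by
    simp [Mmat, tvec, dotProduct, mulVec, Fin.sum_univ_succ, tdeg]
    ring
  simp only [sectionClasses, Set.mem_ofPred_eq, e1, e2, e3]
  constructor
  · rintro ⟨h1, h2, h3⟩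
    subst h3
    exact ⟨rfl, h2, by linarith, by linarith⟩
  · rintro ⟨rfl, h1, h2, h3⟩
    exact ⟨by linarith, h1, rfl⟩

lemma line_identity (a : Fin 3 → Fin 3 → ℤ) :
    ∑ c, ∑ i, lineSum a c i ^ 2 = 3 * ∑ p, ∑ q, a p q ^ 2 + (∑ p, ∑ q, a p q) ^ 2 := by
  simp [Fin.sum_univ_succ, lineSum]
  ring

lemma dm_sum (d : Dat) (c : Fin 4) : dm d c 0 + dm d c 1 + dm d c 2 = -1 := by
  fin_cases c <;> exact tri_sum _ _

lemma dm_sq (d : Dat) : ∑ c, ∑ i, dm d c i ^ 2 = 2 * degZ d + 4 := by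
  have h1 := tri_sq d.1.1 d.2.1.1
  have h2 := tri_sq d.1.2 d.2.1.2
  have h3 := tri_sq (d.1.1 + d.1.2) d.2.2.1
  have h4 := tri_sq (d.1.1 - d.1.2) d.2.2.2
  simp [Fin.sum_univ_four, Fin.sum_univ_three, dm, degZ]
  linarith

lemma dm_dvd (d : Dat) (x y : Fin 3) : (3 : ℤ) ∣ tripleMult (degZ d) (dm d) x y := by
  obtain ⟨⟨r, s⟩, ⟨⟨u1, v1⟩, ⟨u2, v2⟩⟩, ⟨⟨u3, v3⟩, ⟨u4, v4⟩⟩⟩ := d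
  simp only [degZ, coreQ, tripleMult]
  generalize u1 ^ 2 + u1 * v1 + v1 ^ 2 = k1
  generalize u2 ^ 2 + u2 * v2 + v2 ^ 2 = k2
  generalize u3 ^ 2 + u3 * v3 + v3 ^ 2 = k3
  generalize u4 ^ 2 + u4 * v4 + v4 ^ 2 = k4
  fin_cases r <;> fin_cases s <;> fin_cases x <;> fin_cases y <;>
    simp [dm, tri, (by decide : (-1 : Fin 3) = 2), (by decide : (-2 : Fin 3) = 1)] <;> omega

/-- The multiplicities of a datum. -/
def dMult (d : Dat) (x y : Fin 3) : ℤ := tripleMult (degZ d) (dm d) x y / 3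

lemma dMult_spec (d : Dat) (x y : Fin 3) : 3 * dMult d x y = tripleMult (degZ d) (dm d) x y :=
  Int.mul_ediv_cancel' (dm_dvd d x y)

lemma dMult_lineSum (d : Dat) (c : Fin 4) (i : Fin 3) :
    lineSum (dMult d) c i = degZ d + dm d c i := by
  have s0 := dm_sum d 0
  have s1 := dm_sum d 1
  have s2 := dm_sum d 2
  have s3 := dm_sum d 3
  have h00 := dMult_spec d 0 0
  have h01 := dMult_spec d 0 1
  have h02 := dMult_spec d 0 2
  have h10 := dMult_spec d 1 0
  have h11 := dMult_spec d 1 1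
  have h12 := dMult_spec d 1 2
  have h20 := dMult_spec d 2 0
  have h21 := dMult_spec d 2 1
  have h22 := dMult_spec d 2 2
  simp only [tripleMult, Fin.reduceAdd, Fin.reduceSub] at *
  fin_cases c <;> fin_cases i <;> simp [lineSum] at * <;> omega

lemma sum_eq_lineSum (a : Fin 3 → Fin 3 → ℤ) (c : Fin 4) :
    ∑ p, ∑ q, a p q = lineSum a c 0 + lineSum a c 1 + lineSum a c 2 := by
  fin_cases c <;> simp [lineSum, Fin.sum_univ_three] <;> ring

lemma dMult_sum (d : Dat) : ∑ p, ∑ q, dMult d p q = 3 * degZ d - 1 := by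
  have s0 := dm_sum d 0
  rw [sum_eq_lineSum _ 0, dMult_lineSum, dMult_lineSum, dMult_lineSum]
  linarith

lemma dMult_sq (d : Dat) : ∑ p, ∑ q, dMult d p q ^ 2 = degZ d ^ 2 + 1 := by
  have h := line_identity (dMult d)
  have s0 := dm_sum d 0
  have s1 := dm_sum d 1
  have s2 := dm_sum d 2
  have s3 := dm_sum d 3
  have sq := dm_sq d
  rw [dMult_sum] at h
  simp only [dMult_lineSum, Fin.sum_univ_four (M := ℤ), Fin.sum_univ_three (M := ℤ)] at h sq ⊢
  refine mul_left_cancel₀ (three_ne_zero (α := ℤ)) ?_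
  linear_combination -h + 2 * degZ d * (s0 + s1 + s2 + s3) + sq

/-- The parametrisation of section classes. -/
def Phi (d : Dat) : Fin 10 → ℤ := mkClass (degZ d) (dMult d)

lemma Phi_mem (d : Dat) : Phi d ∈ sectionClasses (degZ d) := by
  obtain ⟨h1, h2⟩ := mult_mkClass (degZ d) (dMult d) (dMult_sum d)
  rw [mem_sectionClasses]
  refine ⟨h2, ?_, ?_, ?_⟩
  · have := dMult_sum d
    simp [Fin.sum_univ_three] at this
    simp [Phi, mkClass]
    omega
  · rw [Phi, h1, dMult_sum]
  · rw [Phi, h1, dMult_sq]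

lemma Phi_injective : Function.Injective Phi := by
  intro d e h
  obtain ⟨h1, h2⟩ := mult_mkClass (degZ d) (dMult d) (dMult_sum d)
  obtain ⟨h3, h4⟩ := mult_mkClass (degZ e) (dMult e) (dMult_sum e)
  change mkClass _ _ = mkClass _ _ at h
  rw [h] at h1 h2
  have hdeg : degZ d = degZ e := h2.symm.trans h4
  have hm : dMult d = dMult e := h1.symm.trans h3
  have key : ∀ c, dm d c = dm e c := by
    intro c
    ext i
    have a := dMult_lineSum d c i
    have b := dMult_lineSum e c i
    rw [hm] at a
    linarith
  obtain ⟨a1, b1⟩ := tri_inj (key 0)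
  obtain ⟨a2, b2⟩ := tri_inj (key 1)
  obtain ⟨a3, b3⟩ := tri_inj (key 2)
  obtain ⟨a4, b4⟩ := tri_inj (key 3)
  exact Prod.ext (Prod.ext a1 a2) (Prod.ext (Prod.ext b1 b2) (Prod.ext b3 b4))

lemma Phi_surj {x : Fin 10 → ℤ} {j : ℤ} (hx : x ∈ sectionClasses j) : ∃ d, Phi d = x := by
  rw [mem_sectionClasses] at hx
  obtain ⟨rfl, h1, h2, h3⟩ := hx
  set a := mult x with ha
  set j := tdeg x with hj
  have hs : ∀ c, (fun i => lineSum a c i - j) 0 + (fun i => lineSum a c i - j) 1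
      + (fun i => lineSum a c i - j) 2 = -1 := by
    intro c
    have := sum_eq_lineSum a c
    simp only
    linarith
  choose r y hry using fun c => tri_surj (fun i => lineSum a c i - j) (hs c)
  have hmod : ∀ c, (3 : ℤ) ∣ lineSum a c 1 - lineSum a c 0 - 1 - ((r c).val : ℤ) := by
    intro c
    have := tri_mod (r c) (y c)
    rw [hry] at this
    simpa using this
  have hr2 : r 2 = r 0 + r 1 := by
    have m0 := hmod 0
    have m1 := hmod 1
    have m2 := hmod 2
    have h2' := h2
    simp [lineSum] at m0 m1 m2
    simp [Fin.sum_univ_three] at h2'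
    ext
    rw [Fin.val_add]
    omega
  have hr3 : r 3 = r 0 - r 1 := by
    have m0 := hmod 0
    have m1 := hmod 1
    have m2 := hmod 3
    have h2' := h2
    simp [lineSum] at m0 m1 m2
    simp [Fin.sum_univ_three] at h2'
    ext
    rw [Fin.val_sub]
    omega
  let d : Dat := ((r 0, r 1), ((y 0, y 1), (y 2, y 3)))
  have hdm : ∀ c i, dm d c i = lineSum a c i - j := by
    intro c i
    rw [← congrFun (hry c) i]
    fin_cases c
    · rfl
    · rfl
    · simp [dm, d, hr2]
    · simp [dm, d, hr3]
  have hdeg : degZ d = j := by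
    have e1 := dm_sq d
    have e2 := line_identity a
    rw [h2, h3] at e2
    have e3 : ∑ c, ∑ i, dm d c i ^ 2 = ∑ c, ∑ i, lineSum a c i ^ 2
        - 2 * j * (∑ c, ∑ i, lineSum a c i) + 12 * j ^ 2 := by
      simp only [hdm]
      simp [Fin.sum_univ_four, Fin.sum_univ_three]
      ring
    have e4 : ∑ c, ∑ i, lineSum a c i = 4 * (3 * j - 1) := by
      have s0 := sum_eq_lineSum a 0
      have s1 := sum_eq_lineSum a 1
      have s2 := sum_eq_lineSum a 2
      have s3 := sum_eq_lineSum a 3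
      simp only [Fin.sum_univ_four (M := ℤ) (f := fun c => ∑ i, lineSum a c i)]
      rw [Fin.sum_univ_three (lineSum a 0), Fin.sum_univ_three (lineSum a 1),
        Fin.sum_univ_three (lineSum a 2), Fin.sum_univ_three (lineSum a 3)]
      linarith
    rw [e4, e2, e1] at e3
    nlinarith
  have hmul : dMult d = a := by
    ext p q
    have h := dMult_spec d p q
    simp only [tripleMult, hdm, hdeg] at h
    simp [Fin.sum_univ_three] at h2
    fin_cases p <;> fin_cases q <;> simp [lineSum] at h ⊢ <;> omega
  refine ⟨d, ?_⟩
  rw [Phi, hmul, hdeg]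
  exact mkClass_mult x h2 h1

lemma sectionClasses_eq (j : ℤ) : sectionClasses j = Phi '' {d | degZ d = j} := by
  ext x
  constructor
  · intro hx
    obtain ⟨d, rfl⟩ := Phi_surj hx
    refine ⟨d, ?_, rfl⟩
    have h1 := (Phi_mem d).2.2
    have h2 := hx.2.2
    exact h1.symm.trans h2
  · rintro ⟨d, rfl, rfl⟩
    exact Phi_mem d

lemma degZ_nonneg (d : Dat) : 0 ≤ degZ d :=
  add_nonneg (add_nonneg (coreQ_nonneg _) (coreQ_nonneg _))
    (add_nonneg (coreQ_nonneg _) (coreQ_nonneg _))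

/-! ### Power series -/

section QSeries

open PowerSeries

/-- Gaussian binomial coefficients. -/
def qb {R : Type*} [CommRing R] (q : R) : ℕ → ℕ → R
  | _, 0 => 1
  | 0, _ + 1 => 0
  | m + 1, k + 1 => qb q m k + q ^ (k + 1) * qb q m (k + 1)

lemma qb_zero_right {R : Type*} [CommRing R] (q : R) (m : ℕ) : qb q m 0 = 1 := by
  cases m <;> rfl

lemma qb_eq_zero {R : Type*} [CommRing R] (q : R) :
    ∀ (m k : ℕ), m < k → qb q m k = 0
  | 0, k + 1, _ => rfl
  | m + 1, k + 1, h => by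
    rw [qb, qb_eq_zero q m k (by omega), qb_eq_zero q m (k + 1) (by omega)]
    ring

lemma map_qb {R S : Type*} [CommRing R] [CommRing S] (f : R →+* S) (q : R) :
    ∀ m k, f (qb q m k) = qb (f q) m k
  | m, 0 => by simp [qb_zero_right]
  | 0, k + 1 => by simp [qb]
  | m + 1, k + 1 => by simp [qb, map_qb f q m]

lemma qb_self {R : Type*} [CommRing R] (q : R) (m : ℕ) : qb q m m = 1 := by
  induction m with
  | zero => rfl
  | succ m ih => rw [qb, ih, qb_eq_zero q m (m + 1) (by omega)]; ring

lemma qb_mul {R : Type*} [CommRing R] (q : R) :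
    ∀ a b : ℕ, qb q (a + b) a * ∏ i ∈ Finset.range a, (1 - q ^ (i + 1))
      = ∏ i ∈ Finset.range a, (1 - q ^ (b + i + 1))
  | 0, b => by simp [qb_zero_right]
  | a + 1, 0 => by simp [qb_self]
  | a + 1, b + 1 => by
    have h1 := qb_mul q a (b + 1)
    have h2 := qb_mul q (a + 1) b
    have e : qb q (a + 1 + (b + 1)) (a + 1)
        = qb q (a + (b + 1)) a + q ^ (a + 1) * qb q (a + 1 + b) (a + 1) := by
      rw [show a + 1 + (b + 1) = (a + (b + 1)) + 1 by ring, qb,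
        show a + 1 + b = a + (b + 1) by ring]
    rw [e, add_mul, mul_assoc, h2, Finset.prod_range_succ, ← mul_assoc, h1,
      Finset.prod_range_succ' (fun i => 1 - q ^ (b + i + 1)), Finset.prod_range_succ]
    have e2 : ∀ i, b + (i + 1) + 1 = b + 1 + i + 1 := by intro i; ring
    simp only [e2]
    ring

open Polynomial in
lemma coeff_prod_qb {R : Type*} [CommRing R] (q : R) (m : ℕ) :
    ∀ (w : R) (k : ℕ),
      (∏ i ∈ Finset.range m, (1 + Polynomial.C (w * q ^ i) * Polynomial.X)).coeff k
        = w ^ k * q ^ (k.choose 2) * qb q m k := by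
  induction m with
  | zero =>
    intro w k
    cases k <;> simp [qb, Polynomial.coeff_one]
  | succ m ih =>
    intro w k
    have e : ∀ i, w * q ^ (i + 1) = (w * q) * q ^ i := by intro i; ring
    rw [Finset.prod_range_succ']
    simp only [e]
    rw [mul_add, mul_one, Polynomial.coeff_add, ih, ← mul_assoc]
    cases k with
    | zero => simp [qb_zero_right]
    | succ k =>
      rw [Polynomial.coeff_mul_X, Polynomial.coeff_mul_C, ih, qb, Nat.choose_succ_succ' k 1]
      simp only [Nat.choose_one_right, pow_add, mul_pow]
      ring

lemma prod_split {A : Type*} [CommMonoid A] (f : ℕ → A) (M : ℕ) :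
    ∏ i ∈ Finset.range (3 * M), f i =
      (∏ i ∈ Finset.range M, f (3 * i)) * (∏ i ∈ Finset.range M, f (1 + 3 * i)) *
        (∏ i ∈ Finset.range M, f (2 + 3 * i)) := by
  induction M with
  | zero => simp
  | succ M ih =>
    rw [show 3 * (M + 1) = 3 * M + 1 + 1 + 1 by ring]
    simp only [Finset.prod_range_succ, ih]
    rw [show 3 * M + 1 + 1 = 2 + 3 * M by ring, show 3 * M + 1 = 1 + 3 * M by ring]
    simp only [mul_assoc, mul_left_comm, mul_comm]

/-- The term of the triple product expansion. -/
noncomputable def tT (N k0 k1 k2 : ℕ) : ℤ⟦X⟧ :=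
  (((1 : ℤ⟦X⟧)) ^ k0 * (X ^ 3) ^ (k0.choose 2) * qb (X ^ 3) (2 * N) k0) *
  ((X : ℤ⟦X⟧) ^ k1 * (X ^ 3) ^ (k1.choose 2) * qb (X ^ 3) (2 * N) k1) *
  ((X ^ 2 : ℤ⟦X⟧) ^ k2 * (X ^ 3) ^ (k2.choose 2) * qb (X ^ 3) (2 * N) k2)

lemma triple_identity (N : ℕ) :
    (X : ℤ⟦X⟧) ^ ((3 * N).choose 2) * qb X (3 * (2 * N)) (3 * N) =
      ∑ p ∈ (Finset.HasAntidiagonal.antidiagonal (3 * N)).sigma (fun p => Finset.HasAntidiagonal.antidiagonal p.1),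
        tT N p.2.1 p.2.2 p.1.2 := by
  have h := coeff_prod_qb (X : ℤ⟦X⟧) (3 * (2 * N)) 1 (3 * N)
  rw [one_pow, one_mul] at h
  rw [← h, prod_split]
  have e0 : ∀ i, (1 : ℤ⟦X⟧) * X ^ (3 * i) = 1 * (X ^ 3) ^ i := by
    intro i; rw [pow_mul]
  have e1 : ∀ i, (1 : ℤ⟦X⟧) * X ^ (1 + 3 * i) = X * (X ^ 3) ^ i := by
    intro i; rw [pow_add, pow_mul]; ring
  have e2 : ∀ i, (1 : ℤ⟦X⟧) * X ^ (2 + 3 * i) = X ^ 2 * (X ^ 3) ^ i := by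
    intro i; rw [pow_add, pow_mul]; ring
  simp only [e0, e1, e2]
  rw [Polynomial.coeff_mul, Finset.sum_sigma]
  refine Finset.sum_congr rfl fun p _ => ?_
  rw [Polynomial.coeff_mul, Finset.sum_mul]
  refine Finset.sum_congr rfl fun r _ => ?_
  rw [coeff_prod_qb, coeff_prod_qb, coeff_prod_qb]
  rfl

/-- Agreement of coefficients up to degree `n`. -/
def Agree (n : ℕ) (A B : ℤ⟦X⟧) : Prop := ∀ i ≤ n, coeff i A = coeff i B

lemma Agree.refl (n : ℕ) (A : ℤ⟦X⟧) : Agree n A A := fun _ _ => rfl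

lemma Agree.mul {n : ℕ} {A B A' B' : ℤ⟦X⟧} (h : Agree n A A') (h' : Agree n B B') :
    Agree n (A * B) (A' * B') := by
  intro i hi
  rw [coeff_mul, coeff_mul]
  refine Finset.sum_congr rfl fun p hp => ?_
  have := Finset.HasAntidiagonal.mem_antidiagonal.mp hp
  rw [h _ (by omega), h' _ (by omega)]

lemma Agree.prod {ι : Type*} {n : ℕ} (s : Finset ι) {A B : ι → ℤ⟦X⟧}
    (h : ∀ i ∈ s, Agree n (A i) (B i)) : Agree n (∏ i ∈ s, A i) (∏ i ∈ s, B i) := by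
  classical
  induction s using Finset.induction_on with
  | empty => exact Agree.refl _ _
  | insert a s ha ih =>
    rw [Finset.prod_insert ha, Finset.prod_insert ha]
    exact (h a (by simp)).mul (ih fun i hi => h i (by simp [hi]))

/-- The partition generating function. -/
noncomputable def PP : ℤ⟦X⟧ := PowerSeries.mk fun n => (partitionCount n : ℤ)

/-- Partitions with parts at most `a`. -/
noncomputable def RR (a : ℕ) : ℤ⟦X⟧ :=
  PowerSeries.mk fun n => ((Nat.Partition.restricted n (fun i => i ≤ a)).card : ℤ)

lemma RR_agree (a : ℕ) : Agree a (RR a) PP := by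
  intro i hi
  simp only [RR, PP, coeff_mk, partitionCount, Nat.cast_inj]
  rw [Nat.Partition.restricted, Finset.filter_true_of_mem, Finset.card_univ]
  intro p _ j hj
  have := Multiset.le_sum_of_mem hj
  rw [p.parts_sum] at this
  omega

open scoped PowerSeries.WithPiTopology in
lemma RR_mul (a : ℕ) : RR a * ∏ i ∈ Finset.range a, (1 - (X : ℤ⟦X⟧) ^ (i + 1)) = 1 := by
  have h : RR a = ∏ i ∈ Finset.range a, ∑' j : ℕ, (X : ℤ⟦X⟧) ^ ((i + 1) * j) := by
    rw [RR, Nat.Partition.powerSeriesMk_card_restricted_eq_tprod ℤ (fun i => i ≤ a)]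
    rw [tprod_eq_prod (s := Finset.range a)]
    · refine Finset.prod_congr rfl fun i hi => ?_
      have := Finset.mem_range.mp hi
      rw [if_pos (by omega)]
    · intro i hi
      have : ¬ i < a := fun h => hi (Finset.mem_range.mpr h)
      rw [if_neg (by omega)]
  rw [h, ← Finset.prod_mul_distrib]
  refine Finset.prod_eq_one fun i _ => ?_
  simp only [pow_mul]
  exact PowerSeries.WithPiTopology.tsum_pow_mul_one_sub_of_constantCoeff_eq_zero (by simp)

lemma qb_agree {n a b : ℕ} (ha : n ≤ a) (hb : n ≤ b) : Agree n (qb X (a + b) a) PP := by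
  have h1 := qb_mul (X : ℤ⟦X⟧) a b
  have h2 : qb (X : ℤ⟦X⟧) (a + b) a
      = RR a * ∏ i ∈ Finset.range a, (1 - (X : ℤ⟦X⟧) ^ (b + i + 1)) := by
    rw [← h1]
    linear_combination (- qb (X : ℤ⟦X⟧) (a + b) a) * RR_mul a
  have h3 : Agree n (∏ i ∈ Finset.range a, (1 - (X : ℤ⟦X⟧) ^ (b + i + 1)))
      (∏ i ∈ Finset.range a, 1) := by
    refine Agree.prod _ fun i _ j hj => ?_
    rw [map_sub, coeff_X_pow, if_neg (by omega), sub_zero]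
  have h4 : Agree n (RR a) PP := fun i hi => RR_agree a i (hi.trans ha)
  have h5 := h4.mul h3
  rw [Finset.prod_const_one, mul_one] at h5
  rw [h2]
  exact h5

/-- `P(q³)`. -/
noncomputable def PE : ℤ⟦X⟧ := PowerSeries.expand 3 three_ne_zero PP

lemma qb3_agree {n a b : ℕ} (ha : n ≤ a) (hb : n ≤ b) : Agree n (qb (X ^ 3) (a + b) a) PE := by
  have h : qb (X ^ 3 : ℤ⟦X⟧) (a + b) a
      = PowerSeries.expand 3 three_ne_zero (qb (X : ℤ⟦X⟧) (a + b) a) := by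
    have := map_qb (PowerSeries.expand 3 three_ne_zero : ℤ⟦X⟧ →ₐ[ℤ] ℤ⟦X⟧).toRingHom
      (X : ℤ⟦X⟧) (a + b) a
    simpa using this.symm
  intro i hi
  rw [h, PE, coeff_expand, coeff_expand]
  split_ifs
  · exact qb_agree ha hb _ ((Nat.div_le_self _ _).trans hi)
  · rfl

lemma coreQ_bound {y : ℤ × ℤ} {n : ℤ} (h : coreQ y ≤ n) :
    (-(n + 1) ≤ y.1 ∧ y.1 ≤ n + 1) ∧ (-(n + 1) ≤ y.2 ∧ y.2 ≤ n + 1) := by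
  obtain ⟨u, v⟩ := y
  simp only [coreQ] at *
  refine ⟨⟨?_, ?_⟩, ⟨?_, ?_⟩⟩
  · nlinarith [sq_nonneg (u + 2 * v), sq_nonneg (3 * u + 6 * v + 2), sq_nonneg (u + 1), sq_nonneg u]
  · nlinarith [sq_nonneg (u + 2 * v), sq_nonneg (3 * u + 6 * v + 2), sq_nonneg (u - 1), sq_nonneg u]
  · nlinarith [sq_nonneg (v + 2 * u), sq_nonneg (3 * v + 6 * u - 2), sq_nonneg (v + 1), sq_nonneg v]
  · nlinarith [sq_nonneg (v + 2 * u), sq_nonneg (3 * v + 6 * u - 2), sq_nonneg (v - 1), sq_nonneg v]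

/-- Degree as a natural number. -/
def degN (y : ℤ × ℤ) : ℕ := (coreQ y).toNat

lemma degN_cast (y : ℤ × ℤ) : (degN y : ℤ) = coreQ y := Int.toNat_of_nonneg (coreQ_nonneg y)

/-- A finite set holding all pairs of degree at most `n`. -/
noncomputable def box (n : ℕ) : Finset (ℤ × ℤ) :=
  ((Finset.Icc (-((n : ℤ) + 1)) (n + 1)) ×ˢ (Finset.Icc (-((n : ℤ) + 1)) (n + 1))).filter
    (fun y => degN y ≤ n)

lemma mem_box {n : ℕ} {y : ℤ × ℤ} : y ∈ box n ↔ degN y ≤ n := by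
  simp only [box, Finset.mem_filter, Finset.mem_product, Finset.mem_Icc, and_iff_right_iff_imp]
  intro h
  have := degN_cast y
  exact coreQ_bound (by omega)

/-- Generating function of a graded type. -/
noncomputable def gf {α : Type*} (d : α → ℕ) : ℤ⟦X⟧ :=
  PowerSeries.mk fun n => (Nat.card {a // d a = n} : ℤ)

lemma degN_finite (n : ℕ) : Finite {y // degN y = n} := by
  refine Set.Finite.to_subtype (s := {y | degN y = n}) ((box n).finite_toSet.subset ?_)
  intro y hy
  exact mem_box.mpr (le_of_eq hy)

lemma gf_agree (n : ℕ) : Agree n (gf degN) (∑ y ∈ box n, X ^ degN y) := by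
  intro i hi
  rw [gf, coeff_mk, map_sum]
  simp only [coeff_X_pow]
  rw [Finset.sum_boole, Nat.cast_inj]
  rw [← Nat.card_eq_finsetCard]
  refine Nat.card_congr (Equiv.subtypeEquivRight fun y => ?_)
  rw [Finset.mem_filter, mem_box]
  constructor
  · rintro rfl; exact ⟨hi, rfl⟩
  · exact fun h => h.2.symm

lemma choose_two_cast (k : ℕ) : 2 * ((k.choose 2 : ℕ) : ℤ) = k * (k - 1) := by
  induction k with
  | zero => simp
  | succ k ih =>
    rw [Nat.choose_succ_succ' k 1, Nat.choose_one_right]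
    push_cast
    linarith

lemma tT_eq (N k0 k1 k2 : ℕ) (h : k0 + k1 + k2 = 3 * N) :
    tT N k0 k1 k2 = X ^ ((3 * N).choose 2) * (X ^ degN ((k0 : ℤ) - N, (k2 : ℤ) - N) *
      (qb (X ^ 3) (2 * N) k0 * qb (X ^ 3) (2 * N) k1 * qb (X ^ 3) (2 * N) k2)) := by
  have key : 3 * k0.choose 2 + (k1 + 3 * k1.choose 2) + (2 * k2 + 3 * k2.choose 2)
      = (3 * N).choose 2 + degN ((k0 : ℤ) - N, (k2 : ℤ) - N) := by
    have c0 := choose_two_cast k0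
    have c1 := choose_two_cast k1
    have c2 := choose_two_cast k2
    have c3 := choose_two_cast (3 * N)
    have c4 := degN_cast ((k0 : ℤ) - N, (k2 : ℤ) - N)
    have hk : (k1 : ℤ) = 3 * N - k0 - k2 := by omega
    zify
    refine mul_left_cancel₀ (two_ne_zero (α := ℤ)) ?_
    rw [c4]
    simp only [coreQ]
    push_cast at c3
    rw [hk] at c1 ⊢
    linear_combination 3 * c0 + 3 * c1 + 3 * c2 - c3
  rw [tT, one_pow, one_mul, ← mul_assoc (X ^ ((3 * N).choose 2)), ← pow_add, ← key]
  simp only [pow_add, pow_mul]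
  ring

/-- The 3-core generating function identity. -/
lemma core_identity : gf degN * PE ^ 3 = PP := by
  ext n
  have hN : ∃ N, N = 3 * n + 3 := ⟨_, rfl⟩
  obtain ⟨N, hN⟩ := hN
  have h1 : coeff n PP = coeff n (qb (X : ℤ⟦X⟧) (3 * (2 * N)) (3 * N)) := by
    rw [show 3 * (2 * N) = 3 * N + 3 * N by ring]
    exact (qb_agree (by omega) (by omega) n le_rfl).symm
  have h2 : coeff n (gf degN * PE ^ 3) = ∑ y ∈ box n, coeff n (X ^ degN y * (PE * PE * PE)) := by
    rw [((gf_agree n).mul (Agree.refl n (PE ^ 3))) n le_rfl, Finset.sum_mul, map_sum]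
    refine Finset.sum_congr rfl fun y _ => ?_
    congr 1
    ring
  have h3 := congrArg (coeff (n + (3 * N).choose 2)) (triple_identity N)
  rw [coeff_X_pow_mul, map_sum] at h3
  rw [h1, h2, h3]
  have hb : ∀ y ∈ box n, ∃ a b c : ℕ, (a : ℤ) = N + y.1 ∧ (b : ℤ) = N - y.1 - y.2 ∧
      (c : ℤ) = N + y.2 ∧ n ≤ a ∧ n ≤ b ∧ n ≤ c ∧ n + a ≤ 2 * N ∧ n + b ≤ 2 * N ∧
      n + c ≤ 2 * N := by
    intro y hy
    have hy' := mem_box.mp hy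
    have := degN_cast y
    obtain ⟨⟨b1, b2⟩, b3, b4⟩ := coreQ_bound (y := y) (n := n) (by omega)
    exact ⟨(N + y.1).toNat, (N - y.1 - y.2).toNat, (N + y.2).toNat, by omega, by omega,
      by omega, by omega, by omega, by omega, by omega, by omega, by omega⟩
  refine Finset.sum_of_injOn
    (fun y => (⟨(((N + y.1).toNat + (N - y.1 - y.2).toNat), (N + y.2).toNat),
      ((N + y.1).toNat, (N - y.1 - y.2).toNat)⟩ : (_ : ℕ × ℕ) × (ℕ × ℕ))) ?_ ?_ ?_ ?_
  · intro y hy z hz hyz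
    obtain ⟨a, b, c, h⟩ := hb y hy
    obtain ⟨a', b', c', h'⟩ := hb z hz
    simp only [Sigma.mk.injEq, Prod.mk.injEq, heq_eq_eq] at hyz
    ext <;> omega
  · intro y hy
    obtain ⟨a, b, c, h⟩ := hb y hy
    simp only [Finset.coe_sigma, Set.mem_sigma_iff, Finset.mem_coe,
      Finset.HasAntidiagonal.mem_antidiagonal]
    exact ⟨by omega, trivial⟩
  · rintro ⟨⟨s, k2⟩, ⟨k0, k1⟩⟩ hp hne
    simp only [Finset.mem_sigma, Finset.HasAntidiagonal.mem_antidiagonal] at hp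
    obtain ⟨hp1, rfl⟩ := hp
    have hlt : n < degN ((k0 : ℤ) - N, (k2 : ℤ) - N) := by
      by_contra hle
      apply hne
      refine ⟨((k0 : ℤ) - N, (k2 : ℤ) - N), mem_box.mpr (not_lt.mp hle), ?_⟩
      have e0 : ((N : ℤ) + (k0 - N)).toNat = k0 := by omega
      have e1 : ((N : ℤ) - (k0 - N) - (k2 - N)).toNat = k1 := by omega
      have e2 : ((N : ℤ) + (k2 - N)).toNat = k2 := by omega
      simp only [e0, e1, e2]
    rw [tT_eq N k0 k1 k2 hp1, coeff_X_pow_mul, coeff_X_pow_mul', if_neg (by omega)]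
  · intro y hy
    obtain ⟨a, b, c, ha, hb, hc, h⟩ := hb y hy
    have e0 : ((N : ℤ) + y.1).toNat = a := by omega
    have e1 : ((N : ℤ) - y.1 - y.2).toNat = b := by omega
    have e2 : ((N : ℤ) + y.2).toNat = c := by omega
    simp only [e0, e1, e2]
    have ey : ((a : ℤ) - N, (c : ℤ) - N) = y := by ext <;> simp <;> omega
    rw [tT_eq N a b c (by omega), coeff_X_pow_mul, ey]
    have qa : Agree n (qb (X ^ 3) (2 * N) a) PE := by
      rw [show 2 * N = a + (2 * N - a) by omega]
      exact qb3_agree (by omega) (by omega)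
    have qb' : Agree n (qb (X ^ 3) (2 * N) b) PE := by
      rw [show 2 * N = b + (2 * N - b) by omega]
      exact qb3_agree (by omega) (by omega)
    have qc : Agree n (qb (X ^ 3) (2 * N) c) PE := by
      rw [show 2 * N = c + (2 * N - c) by omega]
      exact qb3_agree (by omega) (by omega)
    exact (((Agree.refl n (X ^ degN y)).mul ((qa.mul qb').mul qc)) n le_rfl).symm

/-- Splitting a fibre of a sum of degrees. -/
def fibreEquiv {α β : Type*} (d : α → ℕ) (e : β → ℕ) (n : ℕ) :
    {p : α × β // d p.1 + e p.2 = n} ≃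
      Σ ij : {ij // ij ∈ Finset.HasAntidiagonal.antidiagonal n},
        {a // d a = ij.1.1} × {b // e b = ij.1.2} where
  toFun p := ⟨⟨(d p.1.1, e p.1.2), Finset.HasAntidiagonal.mem_antidiagonal.mpr p.2⟩,
    ⟨p.1.1, rfl⟩, ⟨p.1.2, rfl⟩⟩
  invFun s := ⟨(s.2.1.1, s.2.2.1), by
    rw [s.2.1.2, s.2.2.2]; exact Finset.HasAntidiagonal.mem_antidiagonal.mp s.1.2⟩
  left_inv p := rfl
  right_inv s := by
    obtain ⟨⟨⟨i, j⟩, h⟩, ⟨a, ha⟩, ⟨b, hb⟩⟩ := s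
    simp only at ha hb
    subst ha hb
    rfl

lemma gf_finite_prod {α β : Type*} (d : α → ℕ) (e : β → ℕ)
    (hd : ∀ n, Finite {a // d a = n}) (he : ∀ n, Finite {b // e b = n}) (n : ℕ) :
    Finite {p : α × β // d p.1 + e p.2 = n} :=
  Finite.of_equiv _ (fibreEquiv d e n).symm

lemma gf_prod {α β : Type*} (d : α → ℕ) (e : β → ℕ)
    (hd : ∀ n, Finite {a // d a = n}) (he : ∀ n, Finite {b // e b = n}) :
    gf (fun p : α × β => d p.1 + e p.2) = gf d * gf e := by
  ext n
  rw [gf, coeff_mk, coeff_mul, Nat.card_congr (fibreEquiv d e n), Nat.card_sigma]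
  simp only [gf, coeff_mk, Nat.card_prod, Nat.cast_mul, Nat.cast_sum]
  exact Finset.sum_coe_sort (Finset.HasAntidiagonal.antidiagonal n)
    (fun x => (Nat.card {a // d a = x.1} : ℤ) * (Nat.card {b // e b = x.2} : ℤ))

lemma fin_finite (n : ℕ) : Finite {a // (fun _ : Fin 3 × Fin 3 => 0) a = n} := inferInstance

lemma gf_fin : gf (fun _ : Fin 3 × Fin 3 => 0) = 9 := by
  ext n
  rw [gf, coeff_mk, show (9 : ℤ⟦X⟧) = C (9 : ℤ) by simp, coeff_C]
  by_cases h : n = 0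
  · subst h
    rw [if_pos rfl, Nat.card_congr (Equiv.subtypeUnivEquiv (fun _ => rfl))]
    simp
  · rw [if_neg h]
    have : IsEmpty {a : Fin 3 × Fin 3 // (fun _ : Fin 3 × Fin 3 => 0) a = n} :=
      ⟨fun a => h a.2.symm⟩
    simp

/-- Degree of a datum as a natural number. -/
def datN (d : Dat) : ℕ :=
  0 + ((degN d.2.1.1 + degN d.2.1.2) + (degN d.2.2.1 + degN d.2.2.2))

lemma datN_cast (d : Dat) : (datN d : ℤ) = degZ d := by
  simp [datN, degZ, degN_cast]

lemma datN_finite (n : ℕ) : Finite {d // datN d = n} :=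
  gf_finite_prod (fun _ => 0) _ fin_finite
    (gf_finite_prod _ _ (gf_finite_prod _ _ degN_finite degN_finite)
      (gf_finite_prod _ _ degN_finite degN_finite)) n

lemma gf_dat : gf datN = 9 * gf degN ^ 4 := by
  have h2 := gf_prod _ _ degN_finite degN_finite
  have f2 := gf_finite_prod _ _ degN_finite degN_finite
  have h4 := gf_prod _ _ f2 f2
  have f4 := gf_finite_prod _ _ f2 f2
  have h := gf_prod _ _ fin_finite f4
  rw [gf_fin, h4, h2] at h
  have e : gf datN = 9 * (gf degN * gf degN * (gf degN * gf degN)) := h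
  rw [e]
  ring

lemma ncard_section (n : ℕ) : (sectionClasses (n : ℤ)).ncard = Nat.card {d // datN d = n} := by
  rw [sectionClasses_eq, Set.ncard_image_of_injective _ Phi_injective]
  rw [← Nat.card_coe_set_eq]
  refine Nat.card_congr (Equiv.subtypeEquivRight fun d => ?_)
  have := datN_cast d
  simp only [Set.mem_ofPred_eq]
  omega

lemma coeff_PP_pow (r n i : ℕ) (hi : i ≤ n) :
    coeff i (PP ^ r) = ∑ k ∈ Fintype.piFinset (fun _ : Fin r => Finset.range (n + 1)),
      (if (∑ l, k l) = i then ∏ l, (partitionCount (k l) : ℤ) else 0) := by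
  have h : Agree n PP (∑ j ∈ Finset.range (n + 1), C (partitionCount j : ℤ) * X ^ j) := by
    intro m hm
    rw [map_sum]
    simp only [coeff_C_mul, coeff_X_pow, mul_ite, mul_one, mul_zero]
    rw [Finset.sum_ite_eq, if_pos (Finset.mem_range.mpr (by omega)), PP, coeff_mk]
  have h2 := Agree.prod (Finset.univ : Finset (Fin r)) (fun l _ => h)
  have h3 := h2 i hi
  rw [Finset.prod_const, Finset.card_univ, Fintype.card_fin, Finset.prod_univ_sum, map_sum] at h3
  rw [h3]
  refine Finset.sum_congr rfl fun k _ => ?_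
  rw [Finset.prod_mul_distrib, Finset.prod_pow_eq_pow_sum, ← map_prod, coeff_C_mul, coeff_X_pow]
  by_cases hh : ∑ l, k l = i
  · simp [hh]
  · rw [if_neg (fun h => hh h.symm), if_neg hh, mul_zero]

lemma coeff_PE_pow (r n i : ℕ) (hi : i ≤ n) :
    coeff i (PE ^ r) = ∑ k ∈ Fintype.piFinset (fun _ : Fin r => Finset.range (n + 1)),
      (if 3 * (∑ l, k l) = i then ∏ l, (partitionCount (k l) : ℤ) else 0) := by
  rw [PE, ← map_pow, coeff_expand]
  split_ifs with h
  · obtain ⟨m, rfl⟩ := h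
    rw [Nat.mul_div_cancel_left _ (by norm_num), coeff_PP_pow r n m (by omega)]
    refine Finset.sum_congr rfl fun k _ => ?_
    congr 1
    exact propext ⟨fun h => by omega, fun h => by omega⟩
  · symm
    refine Finset.sum_eq_zero fun k _ => ?_
    rw [if_neg]
    intro h'
    exact h ⟨_, h'.symm⟩

lemma main_series : gf datN * PE ^ 12 = 9 * PP ^ 4 := by
  rw [gf_dat, ← core_identity]
  ring

end QSeries

/-- Zagier's theta identity
`Θ_{E₈}(q³; q², q, 1, 1, 1, 1, 1, q⁻¹)·P(q³)¹² = 9·P(q)⁴` in explicit lattice form: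
`S j` is empty for `j < 0`, each `S j` is finite, and comparing the `qⁿ`-coefficients
of the two sides gives, for every `n`,
`∑_{j + 3(k₁+⋯+k₁₂) = n} |S j|·p(k₁)⋯p(k₁₂) = 9·∑_{m₁+m₂+m₃+m₄ = n} p(m₁)p(m₂)p(m₃)p(m₄)`. -/
theorem zagier_theta_identity :
    (∀ j : ℤ, j < 0 → sectionClasses j = ∅) ∧
    (∀ j : ℤ, (sectionClasses j).Finite) ∧
    (∀ n : ℕ,
      (∑ j ∈ Finset.range (n + 1),
        ∑ k ∈ Fintype.piFinset (fun _ : Fin 12 => Finset.range (n + 1)),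
          (if j + 3 * (∑ i, k i) = n then
            (sectionClasses (j : ℤ)).ncard * ∏ i, partitionCount (k i) else 0))
      = 9 * ∑ m ∈ Fintype.piFinset (fun _ : Fin 4 => Finset.range (n + 1)),
          (if (∑ i, m i) = n then ∏ i, partitionCount (m i) else 0)) := by
  refine ⟨?_, ?_, ?_⟩
  · intro j hj
    rw [sectionClasses_eq, Set.image_eq_empty]
    ext d
    have := degZ_nonneg d
    simp only [Set.mem_ofPred_eq, Set.mem_empty_iff_false, iff_false]
    omega
  · intro j
    rw [sectionClasses_eq]
    refine Set.Finite.image _ ?_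
    have := datN_finite j.toNat
    refine Set.Finite.subset (s := {d | datN d = j.toNat}) (Set.finite_coe_iff.mp this) ?_
    intro d hd
    have h := datN_cast d
    simp only [Set.mem_ofPred_eq] at hd ⊢
    omega
  · intro n
    have h := congrArg (PowerSeries.coeff n) main_series
    rw [PowerSeries.coeff_mul, show (9 : PowerSeries ℤ) = PowerSeries.C (9 : ℤ) by simp,
      PowerSeries.coeff_C_mul, coeff_PP_pow 4 n n le_rfl,
      Finset.Nat.sum_antidiagonal_eq_sum_range_succ_mk] at h
    rw [← Nat.cast_inj (R := ℤ)]
    simp only [Nat.cast_sum, Nat.cast_mul, Nat.cast_ite, Nat.cast_prod, Nat.cast_zero,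
      Nat.cast_ofNat]
    refine Eq.trans ?_ h
    refine Finset.sum_congr rfl fun j hj => ?_
    have hj' := Finset.mem_range.mp hj
    rw [coeff_PE_pow 12 n (n - j) (by omega), gf, PowerSeries.coeff_mk, Finset.mul_sum,
      ncard_section]
    refine Finset.sum_congr rfl fun k _ => ?_
    rw [mul_ite, mul_zero]
    congr 1
    exact propext ⟨fun h => by omega, fun h => by omega⟩
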